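/- arXiv:1102.3787 — 3 statements merged into one kernel-verified Lean document; each statement's English description precedes it below -/
import Mathlib

section
/- Let (X, μ) be a measure space and let F, G : X → ℝ be measurable, nonnegative, μ-integrable functions with ∫_X F dμ = ∫_X G dμ = V, where V > 0. Assume moreover that 0 < ∫_X √(F·G) dμ and that F is not μ-a.e. equal to G. Then 2√V · arccos( (1/V) ∫_X √(F·G) dμ ) < (π/(2√2)) · 2·(∫_X (√G − √F)² dμ)^{1/2}. -/
open MeasureTheory Real

theorem aux_sin {x : ℝ} (hx : 0 < x) (hx' : x < π / 4) : 2 * √2 / π * x < sin x := by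
  have hp := Real.pi_pos
  have h := strictConcaveOn_sin_Icc.2 (⟨le_rfl, hp.le⟩ : (0 : ℝ) ∈ Set.Icc 0 π)
    (⟨by positivity, by linarith⟩ : π / 4 ∈ Set.Icc 0 π) (by positivity)
    (show 0 < 1 - x / (π / 4) by rw [sub_pos, div_lt_one (by positivity)]; exact hx')
    (show 0 < x / (π / 4) by positivity) (by ring)
  simp only [smul_eq_mul, mul_zero, Real.sin_zero, zero_add, Real.sin_pi_div_four] at h
  have e1 : x / (π / 4) * (π / 4) = x := by field_simp
  rw [e1] at h
  calc _ = x / (π / 4) * (√2 / 2) := by field_simp; ring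
    _ < _ := h

/-- The strict upper bound of Proposition 5.6 with the optimal constant `π/(2√2)`:
the intrinsic (Calabi) distance `2√V arccos((1/V) ∫ √(F G) dμ)` is strictly less than
`π/(2√2)` times the extrinsic (Hellinger-type) distance `2 (∫ (√G − √F)² dμ)^{1/2}`. -/
theorem stmt1 {X : Type*} [MeasurableSpace X] (μ : Measure X) (F G : X → ℝ)
    (hFmeas : Measurable F) (hGmeas : Measurable G)
    (hFnn : ∀ x, 0 ≤ F x) (hGnn : ∀ x, 0 ≤ G x)
    (hFint : Integrable F μ) (hGint : Integrable G μ)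
    (V : ℝ) (hV : 0 < V)
    (hFV : ∫ x, F x ∂μ = V) (hGV : ∫ x, G x ∂μ = V)
    (hpos : 0 < ∫ x, Real.sqrt (F x * G x) ∂μ)
    (hne : ¬ (F =ᵐ[μ] G)) :
    2 * Real.sqrt V * Real.arccos ((1 / V) * ∫ x, Real.sqrt (F x * G x) ∂μ) <
      (Real.pi / (2 * Real.sqrt 2)) *
        (2 * Real.sqrt (∫ x, (Real.sqrt (G x) - Real.sqrt (F x)) ^ 2 ∂μ)) := by
  have hp := Real.pi_pos
  have hsm : Measurable fun x => √(F x * G x) := (hFmeas.mul hGmeas).sqrt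
  have hI : Integrable (fun x => √(F x * G x)) μ := by
    refine (hFint.add hGint).mono' hsm.aestronglyMeasurable (Filter.Eventually.of_forall fun x => ?_)
    have h1 := hFnn x
    have h2 := hGnn x
    rw [Real.norm_of_nonneg (Real.sqrt_nonneg _)]
    apply Real.sqrt_le_iff.2
    simp only [Pi.add_apply]
    exact ⟨by positivity, by nlinarith⟩
  have hpt : ∀ x, (√(G x) - √(F x)) ^ 2 = (F x + G x) - 2 * √(F x * G x) := fun x => by
    rw [Real.sqrt_mul (hFnn x), sub_sq, Real.sq_sqrt (hFnn x), Real.sq_sqrt (hGnn x)]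
    ring
  have hDint : Integrable (fun x => (√(G x) - √(F x)) ^ 2) μ := by
    simp only [hpt]
    exact (hFint.add hGint).sub (hI.const_mul 2)
  have hD : ∫ x, (√(G x) - √(F x)) ^ 2 ∂μ = 2 * V - 2 * ∫ x, √(F x * G x) ∂μ := by
    simp only [hpt]
    rw [integral_sub (f := fun x => F x + G x) (hFint.add hGint) (hI.const_mul 2), integral_add hFint hGint,
      integral_const_mul, hFV, hGV]
    ring
  have hDpos : 0 < ∫ x, (√(G x) - √(F x)) ^ 2 ∂μ := by
    refine lt_of_le_of_ne (integral_nonneg fun x => sq_nonneg _) fun h0 => hne ?_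
    have := (integral_eq_zero_iff_of_nonneg (fun x => sq_nonneg _) hDint).1 h0.symm
    filter_upwards [this] with x hx
    have h3 : √(G x) = √(F x) := by
      have : (√(G x) - √(F x)) ^ 2 = 0 := hx
      exact sub_eq_zero.1 (pow_eq_zero_iff two_ne_zero |>.1 this)
    exact ((Real.sqrt_inj (hGnn x) (hFnn x)).1 h3).symm
  rw [hD] at hDpos ⊢
  set I := ∫ x, √(F x * G x) ∂μ
  have hc0 : 0 < 1 / V * I := by positivity
  have hc1 : 1 / V * I < 1 := by
    rw [one_div, ← div_eq_inv_mul, div_lt_one hV]; linarith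
  set θ := arccos (1 / V * I) with hθ
  have hcos : cos θ = 1 / V * I := Real.cos_arccos (by linarith) hc1.le
  have hθ0 : 0 < θ := Real.arccos_pos.2 hc1
  have hθ1 : θ < π / 2 := Real.arccos_lt_pi_div_two.2 hc0
  have hs := aux_sin (x := θ / 2) (by linarith) (by linarith)
  have hs0 : 0 < sin (θ / 2) := lt_trans (by positivity) hs
  have hIV : I = V * cos θ := by rw [hcos]; field_simp
  have hE : √(2 * V - 2 * I) = 2 * √V * sin (θ / 2) := by
    rw [Real.sqrt_eq_iff_mul_self_eq (by linarith) (by positivity), hIV]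
    have h4 : cos θ = 1 - 2 * sin (θ / 2) ^ 2 := by
      have := Real.cos_two_mul (θ / 2)
      rw [show 2 * (θ / 2) = θ by ring] at this
      rw [this, Real.cos_sq']; ring
    have h5 := Real.mul_self_sqrt hV.le
    rw [h4]
    linear_combination (-4 * sin (θ / 2) ^ 2) * h5
  rw [hE]
  have hV' := Real.sqrt_pos.2 hV
  have h2 : √2 * √2 = 2 := Real.mul_self_sqrt (by norm_num)
  calc 2 * √V * θ = (π / (2 * √2)) * (2 * (2 * √V * (2 * √2 / π * (θ / 2)))) := by
        field_simp
    _ < _ := by gcongr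
end

section
/- For every real x with 0 ≤ x ≤ 1, one has √(2(1 − x)) ≤ arccos x ≤ (π/2)·√(1 − x); moreover, the second inequality is strict whenever 0 < x < 1. -/
open Real

theorem aux_strict (x : ℝ) (hx0 : 0 < x) (hx1 : x < 1) :
    Real.arccos x < (Real.pi / 2) * Real.sqrt (1 - x) := by
  have hp := Real.pi_pos
  have hc : Real.cos (Real.arccos x) = x := Real.cos_arccos (by linarith) hx1.le
  have h0 : 0 < Real.arccos x := Real.arccos_pos.2 hx1
  have h1 : Real.arccos x < Real.pi / 2 := Real.arccos_lt_pi_div_two.2 hx0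
  generalize Real.arccos x = θ at *
  have ha : 0 < 1 - 2 * θ / π := by rw [sub_pos, div_lt_one hp]; linarith
  have hb : 0 < 2 * θ / π := by positivity
  have m0 : (0 : ℝ) ∈ Set.Icc 0 π := ⟨le_rfl, hp.le⟩
  have m1 : π / 4 ∈ Set.Icc 0 π := ⟨by positivity, by linarith⟩
  have hne : (0 : ℝ) ≠ π / 4 := by positivity
  have hs := strictConcaveOn_sin_Icc.2 m0 m1 hne ha hb (by ring)
  have e : 2 * θ / π * (π / 4) = θ / 2 := by field_simp; norm_num
  simp only [smul_eq_mul, mul_zero, zero_add, Real.sin_zero, Real.sin_pi_div_four, e] at hs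
  have hx : 1 - x = 2 * Real.sin (θ / 2) ^ 2 := by
    have := Real.cos_sq' (θ / 2)
    have h2 := Real.cos_two_mul (θ / 2)
    rw [show 2 * (θ / 2) = θ by ring] at h2
    linarith
  have hsp : 0 < Real.sin (θ / 2) := lt_trans (by positivity) hs
  rw [hx, Real.sqrt_mul (by norm_num), Real.sqrt_sq hsp.le]
  have h2 : √2 * √2 = (2 : ℝ) := Real.mul_self_sqrt (by norm_num)
  calc θ = π / 2 * (√2 * (2 * θ / π * (√2 / 2))) := by
        have : π / 2 * (√2 * (2 * θ / π * (√2 / 2))) = (√2 * √2) * θ / 2 := by field_simp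
        rw [this, h2]; ring
    _ < _ := by gcongr

/-- The scalar inequalities underlying Proposition 5.6: for `0 ≤ x ≤ 1`,
`√(2(1−x)) ≤ arccos x ≤ (π/2)√(1−x)`, with the second inequality strict for `0 < x < 1`. -/
theorem stmt6 (x : ℝ) (hx0 : 0 ≤ x) (hx1 : x ≤ 1) :
    (Real.sqrt (2 * (1 - x)) ≤ Real.arccos x ∧
      Real.arccos x ≤ (Real.pi / 2) * Real.sqrt (1 - x)) ∧
    (0 < x → x < 1 → Real.arccos x < (Real.pi / 2) * Real.sqrt (1 - x)) := by
  refine ⟨⟨?_, ?_⟩, aux_strict x⟩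
  · rw [Real.sqrt_le_left (Real.arccos_nonneg x)]
    have := Real.one_sub_sq_div_two_le_cos (x := Real.arccos x)
    rw [Real.cos_arccos (by linarith) hx1] at this
    linarith
  · rcases hx0.eq_or_lt with rfl | h0
    · simp
    rcases hx1.eq_or_lt with rfl | h1
    · simp
    exact (aux_strict x h0 h1).le
end

section
/- Let (X, μ) be a measure space, and let F, G : X → ℝ be measurable, nonnegative, μ-integrable functions with ∫_X F dμ = ∫_X G dμ = V, where V > 0. Set s := (1/V)∫_X √(F·G) dμ and assume s < 1. Let T := 2√V · arccos s, and define f : ℝ × X → ℝ by f(t, x) := [ sin((T − t)/(2√V))·√(F(x)) + sin(t/(2√V))·√(G(x)) ] / sin(T/(2√V)). Then: (i) f(0, x) = √(F(x)) and f(T, x) = √(G(x)) for every x ∈ X; and (ii) for every t ∈ ℝ, 4·∫_X ( (∂f/∂t)(t, x) )² dμ(x) = 1, where (∂f/∂t)(t,x) denotes the derivative of t ↦ f(t,x). -/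
open MeasureTheory Real

/-- The explicit unit-speed geodesics of the Calabi metric on the space of volume forms
of fixed total mass `V` (§4.3): the path `t ↦ f(t,·)² μ`, where
`f(t,x) = [sin((T−t)/(2√V)) √F(x) + sin(t/(2√V)) √G(x)] / sin(T/(2√V))`
and `T = 2√V arccos((1/V)∫√(F G) dμ)`, joins `F μ` to `G μ` and has constant unit speed:
`4 ∫ (∂f/∂t)² dμ = 1`. -/
theorem stmt7 {X : Type*} [MeasurableSpace X] (μ : Measure X) (F G : X → ℝ)
    (hFmeas : Measurable F) (hGmeas : Measurable G)
    (hFnn : ∀ x, 0 ≤ F x) (hGnn : ∀ x, 0 ≤ G x)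
    (hFint : Integrable F μ) (hGint : Integrable G μ)
    (V : ℝ) (hV : 0 < V)
    (hFV : ∫ x, F x ∂μ = V) (hGV : ∫ x, G x ∂μ = V)
    (s : ℝ) (hs : s = (1 / V) * ∫ x, Real.sqrt (F x * G x) ∂μ) (hs1 : s < 1)
    (T : ℝ) (hT : T = 2 * Real.sqrt V * Real.arccos s)
    (f : ℝ → X → ℝ)
    (hf : ∀ t x, f t x =
      (Real.sin ((T - t) / (2 * Real.sqrt V)) * Real.sqrt (F x) +
        Real.sin (t / (2 * Real.sqrt V)) * Real.sqrt (G x)) /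
        Real.sin (T / (2 * Real.sqrt V))) :
    (∀ x, f 0 x = Real.sqrt (F x) ∧ f T x = Real.sqrt (G x)) ∧
    (∀ t : ℝ, 4 * ∫ x, (deriv (fun u => f u x) t) ^ 2 ∂μ = 1) := by
  have hc : 0 < 2 * Real.sqrt V := by positivity
  have hs0 : 0 ≤ s := by
    rw [hs]
    exact mul_nonneg (by positivity) (integral_nonneg fun x => Real.sqrt_nonneg _)
  have hTc : T / (2 * Real.sqrt V) = Real.arccos s := by
    rw [hT]; field_simp
  have hcos : Real.cos (Real.arccos s) = s := Real.cos_arccos (by linarith) hs1.le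
  have hS : 0 < Real.sin (Real.arccos s) := by
    rw [Real.sin_arccos]
    exact Real.sqrt_pos.mpr (by nlinarith)
  have hS2 : Real.sin (Real.arccos s) ^ 2 = 1 - s ^ 2 := by
    have := Real.sin_sq_add_cos_sq (Real.arccos s)
    rw [hcos] at this
    linarith
  have hFG : ∫ x, Real.sqrt (F x * G x) ∂μ = V * s := by
    rw [hs]; field_simp
  have hint : Integrable (fun x => Real.sqrt (F x * G x)) μ := by
    refine (hFint.add hGint).mono' (hFmeas.mul hGmeas).sqrt.aestronglyMeasurable ?_
    refine Filter.Eventually.of_forall fun x => ?_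
    have h1 := hFnn x
    have h2 := hGnn x
    rw [Real.norm_of_nonneg (Real.sqrt_nonneg _)]
    simp only [Pi.add_apply]
    rw [Real.sqrt_le_left (by positivity)]
    nlinarith [mul_nonneg h1 h2]
  constructor
  · intro x
    constructor
    · rw [hf, sub_zero, hTc, zero_div, Real.sin_zero]
      field_simp
      ring
    · rw [hf, sub_self, hTc, zero_div, Real.sin_zero]
      field_simp
      ring
  · intro t
    set c := 2 * Real.sqrt V with hcdef
    set S := Real.sin (Real.arccos s) with hSdef
    have hc2 : c ^ 2 = 4 * V := by
      rw [hcdef, mul_pow, Real.sq_sqrt hV.le]; norm_num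
    set A := Real.cos ((T - t) / c) with hA
    set B := Real.cos (t / c) with hB
    have hAe : A = s * B + S * Real.sin (t / c) := by
      rw [hA, sub_div, hTc, Real.cos_sub, hcos]
    have hkey : A ^ 2 + B ^ 2 - 2 * A * B * s = S ^ 2 := by
      have h1 := Real.sin_sq_add_cos_sq (t / c)
      rw [← hB] at h1
      rw [hAe]
      linear_combination S ^ 2 * h1 - B ^ 2 * hS2
    have hder : ∀ x, deriv (fun u => f u x) t
        = (-A * Real.sqrt (F x) + B * Real.sqrt (G x)) / (c * S) := by
      intro x
      have h1 : HasDerivAt (fun u : ℝ => (T - u) / c) (-1 / c) t :=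
        ((hasDerivAt_id t).const_sub T).div_const c
      have h2 : HasDerivAt (fun u : ℝ => u / c) (1 / c) t :=
        (hasDerivAt_id t).div_const c
      have h3 := ((h1.sin.mul_const (Real.sqrt (F x))).add
        (h2.sin.mul_const (Real.sqrt (G x)))).div_const S
      have h4 : (fun u => f u x) = fun u => (Real.sin ((T - u) / c) * Real.sqrt (F x) +
          Real.sin (u / c) * Real.sqrt (G x)) / S := by
        funext u
        rw [hf, hTc]
      rw [h4]
      refine h3.deriv.trans ?_
      rw [← hA, ← hB]
      field_simp
    have hsq : ∀ x, (deriv (fun u => f u x) t) ^ 2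
        = (1 / (c * S) ^ 2) * ((A ^ 2 * F x + B ^ 2 * G x)
          - 2 * A * B * Real.sqrt (F x * G x)) := by
      intro x
      rw [hder x, Real.sqrt_mul (hFnn x), div_pow]
      have e1 := Real.sq_sqrt (hFnn x)
      have e2 := Real.sq_sqrt (hGnn x)
      rw [div_eq_mul_one_div, mul_comm]
      congr 1
      linear_combination A ^ 2 * e1 + B ^ 2 * e2
    simp_rw [hsq]
    have hadd : Integrable (fun x => A ^ 2 * F x + B ^ 2 * G x) μ :=
      (hFint.const_mul _).add (hGint.const_mul _)
    rw [integral_const_mul, integral_sub hadd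
      (hint.const_mul _), integral_add (hFint.const_mul _) (hGint.const_mul _),
      integral_const_mul, integral_const_mul, integral_const_mul, hFV, hGV, hFG, mul_pow, hc2]
    have hfin : A ^ 2 * V + B ^ 2 * V - 2 * A * B * (V * s) = V * S ^ 2 := by
      linear_combination V * hkey
    rw [hfin]
    field_simp
end
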